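/- arXiv:2209.03675 — 4 statements merged into one kernel-verified Lean document; each statement's English description precedes it below -/
import Mathlib

section
/- Let k ≥ 3 be an integer, let H be a graph with a linear order on its edges, and let B be a 2k double-blocking set for H. Let {π^ℓ, π^r} be a SCUM 3-path meet (with respect to the order and B), let e* be the middle edge of π^ℓ, and suppose e* is the last edge among all edges of π^ℓ ∪ π^r in the order. Then the middle edge of π^r appears together with e* in some pair of B. -/
open SimpleGraph
open scoped ENNReal

noncomputable section

/-- Weighted distance in a graph: the infimum, over all walks from `u` to `v`,
of the total weight of the walk's edges (`⊤` if there is no walk). -/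
def wdist {V : Type} (G : SimpleGraph V) (w : Sym2 V → ℝ≥0∞) (u v : V) : ℝ≥0∞ :=
  ⨅ p : G.Walk u v, (p.edges.map w).sum

/-- Distance in a graph `H` whose edge `(x, y)` is (re)weighted to `δ x y`. -/
def emulDist {V : Type} (H : SimpleGraph V) (δ : V → V → ℝ≥0∞) (u v : V) : ℝ≥0∞ :=
  ⨅ p : H.Walk u v, (p.darts.map (fun d => δ d.toProd.1 d.toProd.2)).sum

/-- `H` is an `f`-edge-fault-tolerant `t`-emulator of the weighted graph `(G, w)`:
for every fault set `F ⊆ E(G)` with `|F| ≤ f`, the graph `H` with every edge `(x,y)`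
reweighted to `dist_{G∖F}(x,y)` approximates all distances of `G ∖ F` within factor `t`. -/
def IsEFTEmulator {V : Type} (G : SimpleGraph V) (w : Sym2 V → ℝ≥0∞)
    (H : SimpleGraph V) (f : ℕ) (t : ℝ≥0∞) : Prop :=
  ∀ F : Finset (Sym2 V), ↑F ⊆ G.edgeSet → F.card ≤ f →
    ∀ u v : V,
      wdist (G.deleteEdges ↑F) w u v ≤ emulDist H (wdist (G.deleteEdges ↑F) w) u v ∧
      emulDist H (wdist (G.deleteEdges ↑F) w) u v ≤ t * wdist (G.deleteEdges ↑F) w u v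

/-- `e` is the last edge of the list `l` in the order given by the ranking `π`. -/
def IsLastEdge {V : Type} (π : Sym2 V → ℕ) (l : List (Sym2 V)) (e : Sym2 V) : Prop :=
  e ∈ l ∧ ∀ e' ∈ l, π e' ≤ π e

/-- The cycle `p` is blocked by the unordered pair `b` of edges: both members of `b`
lie on `p` and one of them is the last edge of `p` in the order `π`. -/
def CycleBlockedBy {V : Type} {H : SimpleGraph V} (π : Sym2 V → ℕ) {u : V}
    (p : H.Walk u u) (b : Sym2 (Sym2 V)) : Prop :=
  ∃ e1 e2 : Sym2 V, b = s(e1, e2) ∧ e1 ∈ p.edges ∧ e2 ∈ p.edges ∧ IsLastEdge π p.edges e1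

/-- `B` is a `2k` double-blocking set for `H` with edge order `π`: it consists of
unordered pairs of distinct edges of `H`, every cycle with at most `2k` edges is blocked
by a member of `B`, and every cycle with at most `k+1` edges is blocked by two
distinct members of `B`. -/
def IsDoubleBlockingSet {V : Type} (H : SimpleGraph V) (π : Sym2 V → ℕ) (k : ℕ)
    (B : Finset (Sym2 (Sym2 V))) : Prop :=
  (∀ b ∈ B, ¬ b.IsDiag ∧ ∀ e ∈ b, e ∈ H.edgeSet) ∧
  (∀ (u : V) (p : H.Walk u u), p.IsCycle → p.length ≤ 2 * k →
      ∃ b ∈ B, CycleBlockedBy π p b) ∧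
  (∀ (u : V) (p : H.Walk u u), p.IsCycle → p.length ≤ k + 1 →
      ∃ b1 ∈ B, ∃ b2 ∈ B, b1 ≠ b2 ∧ CycleBlockedBy π p b1 ∧ CycleBlockedBy π p b2)

/-- The number of pairs of `B` containing the edge `e`. -/
def edgeBlockCount {V : Type} (B : Finset (Sym2 (Sym2 V))) (e : Sym2 V) : ℕ :=
  {b ∈ (B : Set (Sym2 (Sym2 V))) | e ∈ b}.ncard

/-- The `i`-th edge of the vertex sequence `v`. -/
def edgeOf {V : Type} {k : ℕ} (v : Fin (k + 1) → V) (i : Fin k) : Sym2 V :=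
  s(v i.castSucc, v i.succ)

/-- The average degree `2|E(H)|/n` of a graph on `n` vertices. -/
def avgDeg {V : Type} [Fintype V] (H : SimpleGraph V) : ℝ :=
  2 * (H.edgeSet.ncard : ℝ) / (Fintype.card V : ℝ)

end
noncomputable section

/-- `v` is a SCUM `k`-path (for odd `k`), viewed as an oriented sequence of `k+1`
distinct pairwise-adjacent vertices: it is simple, its middle edge (the edge with
0-indexed position `(k-1)/2`, i.e. the index `j` with `2j+1 = k`) is the last edge
of the path in the order `π`, and the two oriented subpaths starting from the middle
edge and going towards either endpoint are chain-unblocked with respect to `B`. -/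
def IsSCUM {V : Type} (H : SimpleGraph V) (π : Sym2 V → ℕ) (B : Finset (Sym2 (Sym2 V)))
    (k : ℕ) (v : Fin (k + 1) → V) : Prop :=
  Function.Injective v ∧
  (∀ i : Fin k, H.Adj (v i.castSucc) (v i.succ)) ∧
  (∀ i j : Fin k, 2 * (j : ℕ) + 1 = k → π (edgeOf v i) ≤ π (edgeOf v j)) ∧
  (∀ (i : Fin k) (j : Fin (k + 1)), 2 * (i : ℕ) + 1 ≤ k → (j : ℕ) + 1 ≤ (i : ℕ) →
      ∀ e' : Sym2 V, s(edgeOf v i, e') ∈ B → v j ∉ e') ∧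
  (∀ (i : Fin k) (j : Fin (k + 1)), k ≤ 2 * (i : ℕ) + 1 → (i : ℕ) + 2 ≤ (j : ℕ) →
      ∀ e' : Sym2 V, s(edgeOf v i, e') ∈ B → v j ∉ e')

/-- The number of (oriented) SCUM `k`-paths of `H`. -/
def scumCount {V : Type} (H : SimpleGraph V) (π : Sym2 V → ℕ)
    (B : Finset (Sym2 (Sym2 V))) (k : ℕ) : ℕ :=
  {v : Fin (k + 1) → V | IsSCUM H π B k v}.ncard

/-- The number of (oriented, aligned) SCUM `k`-path meets of `H`: pairs of distinct
SCUM `k`-paths sharing both endpoints. -/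
def scumMeetCount {V : Type} (H : SimpleGraph V) (π : Sym2 V → ℕ)
    (B : Finset (Sym2 (Sym2 V))) (k : ℕ) : ℕ :=
  {vv : (Fin (k + 1) → V) × (Fin (k + 1) → V) |
    IsSCUM H π B k vv.1 ∧ IsSCUM H π B k vv.2 ∧ vv.1 ≠ vv.2 ∧
    vv.1 0 = vv.2 0 ∧ vv.1 (Fin.last k) = vv.2 (Fin.last k)}.ncard

/-- The oriented path given by the vertex sequence `a` is chain-unblocked with
respect to `B`: for any edge `e` of the path and any vertex `x` strictly following
`e` along the path, no pair `{e, e'} ∈ B` has `e'` incident on `x`. -/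
def ChainUnblockedSeq {V : Type} (B : Finset (Sym2 (Sym2 V))) {L : ℕ}
    (a : Fin (L + 1) → V) : Prop :=
  ∀ (i : Fin L) (j : Fin (L + 1)), (i : ℕ) + 2 ≤ (j : ℕ) →
    ∀ e' : Sym2 V, s(edgeOf a i, e') ∈ B → a j ∉ e'

/-- The walk `p` is blocked: some pair of `B` has both its edges on `p`. -/
def PathBlocked {V : Type} {H : SimpleGraph V} (B : Finset (Sym2 (Sym2 V)))
    {u v : V} (p : H.Walk u v) : Prop :=
  ∃ b ∈ B, ∀ e ∈ b, e ∈ p.edges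

/-- The walk `p` is double-blocked: two distinct pairs of `B` have both their edges on `p`. -/
def PathDoubleBlocked {V : Type} {H : SimpleGraph V} (B : Finset (Sym2 (Sym2 V)))
    {u v : V} (p : H.Walk u v) : Prop :=
  ∃ b1 ∈ B, ∃ b2 ∈ B, b1 ≠ b2 ∧ (∀ e ∈ b1, e ∈ p.edges) ∧ (∀ e ∈ b2, e ∈ p.edges)

/-- The subgraph of `H` consisting of the edge `e` together with all edges
preceding it in the order `π`. -/
def subEdges {V : Type} (H : SimpleGraph V) (π : Sym2 V → ℕ) (e : Sym2 V) : SimpleGraph V :=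
  SimpleGraph.fromEdgeSet {e' ∈ H.edgeSet | π e' ≤ π e}

/-- `e` is a core edge of `H` (with respect to edge order `π` and degree threshold `d/4`):
`e` survives in the graph obtained from the subgraph of edges up to `e` by iteratively
deleting vertices of degree at most `d/4`; equivalently, there is a set `S` of vertices
containing both endpoints of `e` on which the subgraph of edges up to `e` induces
a graph of minimum degree greater than `d/4`. -/
def IsCoreEdge {V : Type} (H : SimpleGraph V) (π : Sym2 V → ℕ) (d : ℝ) (e : Sym2 V) : Prop :=
  e ∈ H.edgeSet ∧
  ∃ S : Set V, (∀ x ∈ e, x ∈ S) ∧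
    ∀ v ∈ S, d / 4 < ({u ∈ S | (subEdges H π e).Adj v u}.ncard : ℝ)

end

/-- A short cycle whose last edge is `e` is blocked by a pair of `B` joining `e` to
another edge of the cycle. -/
theorem IsDoubleBlockingSet.exists_mem_edges {V : Type} {H : SimpleGraph V} {π : Sym2 V → ℕ}
    {k : ℕ} {B : Finset (Sym2 (Sym2 V))} (hB : IsDoubleBlockingSet H π k B)
    (hπ : Set.InjOn π H.edgeSet) {u : V} {p : H.Walk u u} (hp : p.IsCycle)
    (hlen : p.length ≤ 2 * k) {e : Sym2 V} (he : IsLastEdge π p.edges e) :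
    ∃ e' ∈ p.edges, e' ≠ e ∧ s(e, e') ∈ B := by
  obtain ⟨b, hb, e₁, e₂, rfl, h₁, h₂, hmax⟩ := hB.2.1 u p hp hlen
  obtain rfl : e₁ = e := hπ (p.edges_subset_edgeSet h₁) (p.edges_subset_edgeSet he.1)
    (le_antisymm (he.2 _ h₁) (hmax.2 _ he.1))
  refine ⟨e₂, h₂, ?_, hb⟩
  rintro rfl
  exact (hB.1 _ hb).1 rfl

/-- If `xy` is the last edge of a triangle `xyz`, then it is blocked with an edge at `z`. -/
theorem IsDoubleBlockingSet.exists_of_triangle {V : Type} {H : SimpleGraph V} {π : Sym2 V → ℕ}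
    {k : ℕ} {B : Finset (Sym2 (Sym2 V))} (hB : IsDoubleBlockingSet H π k B)
    (hπ : Set.InjOn π H.edgeSet) (hk : 3 ≤ k) {x y z : V}
    (hxy : H.Adj x y) (hyz : H.Adj y z) (hzx : H.Adj z x)
    (h₁ : π s(y, z) ≤ π s(x, y)) (h₂ : π s(z, x) ≤ π s(x, y)) :
    ∃ e', s(s(x, y), e') ∈ B ∧ z ∈ e' := by
  obtain ⟨e', he', hne, hmem⟩ := hB.exists_mem_edges hπ
    (p := .cons hxy (.cons hyz (.cons hzx .nil))) (e := s(x, y))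
    (by simp [Walk.cons_isCycle_iff, hxy.ne, hxy.ne', hyz.ne, hzx.ne, hzx.ne'])
    (by simp; omega) ⟨by simp, by simp [h₁, h₂]⟩
  refine ⟨e', hmem, ?_⟩
  simp only [Walk.edges_cons, Walk.edges_nil, List.mem_cons, List.not_mem_nil, or_false] at he'
  rcases he' with rfl | rfl | rfl
  · exact absurd rfl hne
  · exact Sym2.mem_mk_right _ _
  · exact Sym2.mem_mk_left _ _

/-- If `xy` is the last edge of a 4-cycle `xyzw` and is not blocked with an edge at `z`,
then it is blocked with `wx`. -/
theorem IsDoubleBlockingSet.mem_of_quadrilateral {V : Type} {H : SimpleGraph V}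
    {π : Sym2 V → ℕ} {k : ℕ} {B : Finset (Sym2 (Sym2 V))} (hB : IsDoubleBlockingSet H π k B)
    (hπ : Set.InjOn π H.edgeSet) (hk : 3 ≤ k) {x y z w : V}
    (hxy : H.Adj x y) (hyz : H.Adj y z) (hzw : H.Adj z w) (hwx : H.Adj w x)
    (hxz : x ≠ z) (hyw : y ≠ w)
    (h₁ : π s(y, z) ≤ π s(x, y)) (h₂ : π s(z, w) ≤ π s(x, y)) (h₃ : π s(w, x) ≤ π s(x, y))
    (hz : ∀ e', s(s(x, y), e') ∈ B → z ∉ e') :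
    s(s(x, y), s(w, x)) ∈ B := by
  obtain ⟨e', he', hne, hmem⟩ := hB.exists_mem_edges hπ
    (p := .cons hxy (.cons hyz (.cons hzw (.cons hwx .nil)))) (e := s(x, y))
    (by simp [Walk.cons_isCycle_iff, hxy.ne, hxy.ne', hyz.ne, hzw.ne, hwx.ne, hwx.ne', hxz,
          hxz.symm, hyw])
    (by simp; omega) ⟨by simp, by simp [h₁, h₂, h₃]⟩
  simp only [Walk.edges_cons, Walk.edges_nil, List.mem_cons, List.not_mem_nil, or_false] at he'
  rcases he' with rfl | rfl | rfl | rfl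
  · exact absurd rfl hne
  · exact absurd (Sym2.mem_mk_right _ _) (hz _ hmem)
  · exact absurd (Sym2.mem_mk_left _ _) (hz _ hmem)
  · exact hmem

/-- If `ab` is the last edge of a 6-cycle `sabtdc` and is blocked neither with an edge at `s`
nor with one at `t`, then it is blocked with the opposite edge `cd`. -/
theorem IsDoubleBlockingSet.mem_of_hexagon {V : Type} {H : SimpleGraph V}
    {π : Sym2 V → ℕ} {k : ℕ} {B : Finset (Sym2 (Sym2 V))} (hB : IsDoubleBlockingSet H π k B)
    (hπ : Set.InjOn π H.edgeSet) (hk : 3 ≤ k) {s a b t c d : V}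
    (hsa : H.Adj s a) (hab : H.Adj a b) (hbt : H.Adj b t)
    (hsc : H.Adj s c) (hcd : H.Adj c d) (hdt : H.Adj d t)
    (hnodup : [s, a, b, t, d, c].Nodup)
    (h₁ : π s(s, a) ≤ π s(a, b)) (h₂ : π s(b, t) ≤ π s(a, b)) (h₃ : π s(s, c) ≤ π s(a, b))
    (h₄ : π s(c, d) ≤ π s(a, b)) (h₅ : π s(d, t) ≤ π s(a, b))
    (hs : ∀ e', s(s(a, b), e') ∈ B → s ∉ e') (ht : ∀ e', s(s(a, b), e') ∈ B → t ∉ e') :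
    s(s(a, b), s(c, d)) ∈ B := by
  obtain ⟨e', he', hne, hmem⟩ := hB.exists_mem_edges hπ
    (p := .cons hsc.symm (.cons hsa (.cons hab (.cons hbt (.cons hdt.symm
      (.cons hcd.symm .nil)))))) (e := s(a, b))
    (by
      simp only [List.nodup_cons, List.mem_cons, List.not_mem_nil, or_false, not_or] at hnodup
      simp only [Walk.cons_isCycle_iff, Walk.cons_isPath_iff, Walk.IsPath.nil, Walk.support_cons,
        Walk.support_nil, Walk.edges_cons, Walk.edges_nil, List.mem_cons, List.not_mem_nil,
        or_false, Sym2.eq_iff, not_or, true_and]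
      grind)
    (by simp; omega)
    ⟨by simp, by simp [h₁, h₂, h₃, h₄, h₅, Sym2.eq_swap (a := c) (b := s),
      Sym2.eq_swap (a := t) (b := d), Sym2.eq_swap (a := d) (b := c)]⟩
  simp only [Walk.edges_cons, Walk.edges_nil, List.mem_cons, List.not_mem_nil, or_false] at he'
  rcases he' with rfl | rfl | rfl | rfl | rfl | rfl
  · exact absurd (Sym2.mem_mk_right _ _) (hs _ hmem)
  · exact absurd (Sym2.mem_mk_left _ _) (hs _ hmem)
  · exact absurd rfl hne
  · exact absurd (Sym2.mem_mk_right _ _) (ht _ hmem)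
  · exact absurd (Sym2.mem_mk_left _ _) (ht _ hmem)
  · rwa [Sym2.eq_swap (a := c)]

/-- The 3-path meet argument for explicit vertex sequences `s, a, b, t` and `s, c, d, t`. -/
theorem IsDoubleBlockingSet.mem_of_threePath_meet {V : Type} {H : SimpleGraph V}
    {π : Sym2 V → ℕ} {k : ℕ} {B : Finset (Sym2 (Sym2 V))} (hB : IsDoubleBlockingSet H π k B)
    (hπ : Set.InjOn π H.edgeSet) (hk : 3 ≤ k) {s a b t c d : V}
    (hsa : H.Adj s a) (hab : H.Adj a b) (hbt : H.Adj b t)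
    (hsc : H.Adj s c) (hcd : H.Adj c d) (hdt : H.Adj d t)
    (hst : s ≠ t) (hsb : s ≠ b) (hat : a ≠ t) (hsd : s ≠ d) (hct : c ≠ t)
    (hne : ¬(a = c ∧ b = d))
    (h₁ : π s(s, a) ≤ π s(a, b)) (h₂ : π s(b, t) ≤ π s(a, b)) (h₃ : π s(s, c) ≤ π s(a, b))
    (h₄ : π s(c, d) ≤ π s(a, b)) (h₅ : π s(d, t) ≤ π s(a, b))
    (hs : ∀ e', s(s(a, b), e') ∈ B → s ∉ e') (ht : ∀ e', s(s(a, b), e') ∈ B → t ∉ e') :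
    s(s(a, b), s(c, d)) ∈ B := by
  by_cases had : a = d
  · subst had
    obtain ⟨e', he', hmem⟩ := hB.exists_of_triangle hπ hk hab hbt hdt.symm h₂
      (by rwa [Sym2.eq_swap (a := t)])
    exact absurd hmem (ht e' he')
  by_cases hbc : b = c
  · subst hbc
    obtain ⟨e', he', hmem⟩ := hB.exists_of_triangle hπ hk hab hsc.symm hsa
      (by rwa [Sym2.eq_swap (a := b) (b := s)]) h₁
    exact absurd hmem (hs e' he')
  by_cases hac : a = c
  · subst hac
    have hbd : b ≠ d := fun h => hne ⟨rfl, h⟩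
    rw [Sym2.eq_swap (a := a) (b := d)] at h₄ ⊢
    rw [Sym2.eq_swap (a := d) (b := t)] at h₅
    exact hB.mem_of_quadrilateral hπ hk hab hbt hdt.symm hcd.symm hat hbd h₂ h₅ h₄ ht
  by_cases hbd : b = d
  · subst hbd
    rw [Sym2.eq_swap (a := a) (b := b)] at *
    rw [Sym2.eq_swap (a := s) (b := a)] at h₁
    exact hB.mem_of_quadrilateral hπ hk hab.symm hsa.symm hsc hcd hsb.symm hac h₁ h₃ h₄ hs
  refine hB.mem_of_hexagon hπ hk hsa hab hbt hsc hcd hdt ?_ h₁ h₂ h₃ h₄ h₅ hs ht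
  have := hsa.ne
  have := hab.ne
  have := hbt.ne
  have := hsc.ne
  have := hcd.ne
  have := hdt.ne
  simp only [List.nodup_cons, List.mem_cons, List.not_mem_nil, or_false, not_or]
  grind

/-- Let `k ≥ 3`, let `H` have a linear order on its edges and a `2k`
double-blocking set `B`. Let `{π^ℓ, π^r}` be a SCUM `3`-path meet, let `e*` be the
middle edge of `π^ℓ`, and suppose `e*` is the last edge among all edges of `π^ℓ ∪ π^r`
in the order. Then the middle edge of `π^r` appears together with `e*` in a pair of `B`. -/
theorem statement_14 {V : Type} (k : ℕ) (hk : 3 ≤ k) (H : SimpleGraph V)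
    (π : Sym2 V → ℕ) (hπ : Set.InjOn π H.edgeSet)
    (B : Finset (Sym2 (Sym2 V))) (hB : IsDoubleBlockingSet H π k B)
    (vl vr : Fin 4 → V)
    (hl : IsSCUM H π B 3 vl) (hr : IsSCUM H π B 3 vr)
    (hne : vl ≠ vr) (h0 : vl 0 = vr 0) (h3 : vl 3 = vr 3)
    (hlast : ∀ i : Fin 3,
      π (edgeOf vl i) ≤ π (edgeOf vl 1) ∧ π (edgeOf vr i) ≤ π (edgeOf vl 1)) :
    s(edgeOf vl 1, edgeOf vr 1) ∈ B := by
  obtain ⟨hlinj, hladj, -, hlstart, hlend⟩ := hl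
  obtain ⟨hrinj, hradj, -, -, -⟩ := hr
  have hsc := hradj 0
  have hdt := hradj 2
  have h₃ := (hlast 0).2
  have h₅ := (hlast 2).2
  change H.Adj (vr 0) (vr 1) at hsc
  change H.Adj (vr 2) (vr 3) at hdt
  change π s(vr 0, vr 1) ≤ _ at h₃
  change π s(vr 2, vr 3) ≤ _ at h₅
  rw [← h0] at hsc h₃
  rw [← h3] at hdt h₅
  refine hB.mem_of_threePath_meet hπ hk (hladj 0) (hladj 1) (hladj 2) hsc (hradj 1) hdt
    (hlinj.ne (by decide)) (hlinj.ne (by decide)) (hlinj.ne (by decide)) ?_ ?_ ?_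
    (hlast 0).1 (hlast 2).1 h₃ (hlast 1).2 h₅
    (hlstart 1 0 (by decide) (by decide)) (hlend 1 3 (by decide) (by decide))
  · change vl 0 ≠ vr 2
    rw [h0]
    exact hrinj.ne (by decide)
  · change vr 1 ≠ vl 3
    rw [h3]
    exact hrinj.ne (by decide)
  · rintro ⟨h1, h2⟩
    refine hne (funext fun i => ?_)
    fin_cases i
    exacts [h0, h1, h2, h3]
end

section
/- Let k ≥ 3 be an integer, let H be a graph with a linear order on its edges, and let B be a 2k double-blocking set for H. Then in any SCUM 3-path meet {π^ℓ, π^r} (with respect to the order and B), the paths π^ℓ and π^r are internally vertex disjoint: they intersect only at their two common endpoints and share no other vertices. -/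
open SimpleGraph
open scoped ENNReal

/-- A pair of `B` blocking a cycle whose last edge is `e` has the form `{e, e'}` with `e'` another
edge of the cycle. -/
theorem CycleBlockedBy.exists_eq_mk {V : Type} {k : ℕ} {H : SimpleGraph V} {π : Sym2 V → ℕ}
    (hπ : Set.InjOn π H.edgeSet) {B : Finset (Sym2 (Sym2 V))} (hB : IsDoubleBlockingSet H π k B)
    {u : V} {p : H.Walk u u} {e : Sym2 V} (he : IsLastEdge π p.edges e)
    {b : Sym2 (Sym2 V)} (hb : b ∈ B) (h : CycleBlockedBy π p b) :
    ∃ e' ∈ p.edges, e' ≠ e ∧ b = s(e, e') := by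
  obtain ⟨e₁, e₂, rfl, h₁, h₂, hlast⟩ := h
  have heq : e₁ = e := hπ (p.edges_subset_edgeSet h₁) (p.edges_subset_edgeSet he.1)
    (le_antisymm (he.2 _ h₁) (hlast.2 _ he.1))
  subst heq
  exact ⟨e₂, h₂, fun h => (hB.1 _ hb).1 (by simp [h]), rfl⟩

/-- In a triangle whose last edge is `xy`, that edge is paired with an edge at the opposite
vertex. -/
theorem IsDoubleBlockingSet.exists_mem_of_triangle {V : Type} {k : ℕ} (hk : 3 ≤ k)
    {H : SimpleGraph V} {π : Sym2 V → ℕ} (hπ : Set.InjOn π H.edgeSet)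
    {B : Finset (Sym2 (Sym2 V))} (hB : IsDoubleBlockingSet H π k B) {x y z : V}
    (hxy : H.Adj x y) (hyz : H.Adj y z) (hzx : H.Adj z x)
    (h₁ : π s(y, z) ≤ π s(x, y)) (h₂ : π s(z, x) ≤ π s(x, y)) :
    ∃ e', s(s(x, y), e') ∈ B ∧ z ∈ e' := by
  let p : H.Walk x x := .cons hxy (.cons hyz (.cons hzx .nil))
  have hp : p.IsCycle := by
    have := hxy.ne
    have := hyz.ne
    have := hzx.ne
    rw [Walk.isCycle_def, Walk.isTrail_def]
    simp [p]
    grind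
  obtain ⟨b, hb, hblock⟩ := hB.2.1 x p hp (by simp [p]; omega)
  have hlast : IsLastEdge π p.edges s(x, y) := by simp [IsLastEdge, p, h₁, h₂]
  obtain ⟨e', he', hne, rfl⟩ := hblock.exists_eq_mk hπ hB hlast hb
  simp only [p, Walk.edges_cons, Walk.edges_nil, List.mem_cons, List.not_mem_nil, or_false] at he'
  rcases he' with rfl | rfl | rfl
  · exact absurd rfl hne
  · exact ⟨_, hb, by simp⟩
  · exact ⟨_, hb, by simp⟩

/-- In a 4-cycle `xyzw` whose last edge is `xy`, that edge is paired with an edge at `z`. -/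
theorem IsDoubleBlockingSet.exists_mem_of_square {V : Type} {k : ℕ} (hk : 3 ≤ k)
    {H : SimpleGraph V} {π : Sym2 V → ℕ} (hπ : Set.InjOn π H.edgeSet)
    {B : Finset (Sym2 (Sym2 V))} (hB : IsDoubleBlockingSet H π k B) {x y z w : V}
    (hxy : H.Adj x y) (hyz : H.Adj y z) (hzw : H.Adj z w) (hwx : H.Adj w x)
    (hxz : x ≠ z) (hyw : y ≠ w) (h₁ : π s(y, z) ≤ π s(x, y)) (h₂ : π s(z, w) ≤ π s(x, y))
    (h₃ : π s(w, x) ≤ π s(x, y)) :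
    ∃ e', s(s(x, y), e') ∈ B ∧ z ∈ e' := by
  let p : H.Walk x x := .cons hxy (.cons hyz (.cons hzw (.cons hwx .nil)))
  have hp : p.IsCycle := by
    have := hxy.ne
    have := hyz.ne
    have := hzw.ne
    have := hwx.ne
    rw [Walk.isCycle_def, Walk.isTrail_def]
    simp [p]
    grind
  obtain ⟨b, hb, b', hb', hne, hblock, hblock'⟩ := hB.2.2 x p hp (by simp [p]; omega)
  have hlast : IsLastEdge π p.edges s(x, y) := by simp [IsLastEdge, p, h₁, h₂, h₃]
  have key : ∀ c ∈ B, CycleBlockedBy π p c → c ≠ s(s(x, y), s(w, x)) →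
      ∃ e', s(s(x, y), e') ∈ B ∧ z ∈ e' := by
    intro c hc hcb hcne
    obtain ⟨e', he', hne, rfl⟩ := hcb.exists_eq_mk hπ hB hlast hc
    simp only [p, Walk.edges_cons, Walk.edges_nil, List.mem_cons, List.not_mem_nil,
      or_false] at he'
    rcases he' with rfl | rfl | rfl | rfl
    · exact absurd rfl hne
    · exact ⟨_, hc, by simp⟩
    · exact ⟨_, hc, by simp⟩
    · exact absurd rfl hcne
  by_cases h : b = s(s(x, y), s(w, x))
  · exact key b' hb' hblock' fun h' => hne (h.trans h'.symm)
  · exact key b hb hblock h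

/-- The conditions on a SCUM 3-path, spelled out. -/
theorem IsSCUM.three {V : Type} {H : SimpleGraph V} {π : Sym2 V → ℕ}
    {B : Finset (Sym2 (Sym2 V))} {v : Fin 4 → V} (h : IsSCUM H π B 3 v) :
    H.Adj (v 0) (v 1) ∧ H.Adj (v 1) (v 2) ∧ H.Adj (v 2) (v 3) ∧
    π s(v 0, v 1) ≤ π s(v 1, v 2) ∧ π s(v 2, v 3) ≤ π s(v 1, v 2) ∧
    (∀ e', s(s(v 1, v 2), e') ∈ B → v 0 ∉ e') ∧ (∀ e', s(s(v 1, v 2), e') ∈ B → v 3 ∉ e') :=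
  ⟨h.2.1 0, h.2.1 1, h.2.1 2, h.2.2.1 0 1 rfl, h.2.2.1 2 1 rfl,
    h.2.2.2.1 1 0 (by simp) (by simp), h.2.2.2.2 1 3 (by simp) (by simp)⟩

/-- In two SCUM 3-paths with common endpoints, the second vertex of one is not the third vertex of
the other. -/
theorem IsSCUM.one_ne_two {V : Type} {k : ℕ} (hk : 3 ≤ k) {H : SimpleGraph V}
    {π : Sym2 V → ℕ} (hπ : Set.InjOn π H.edgeSet) {B : Finset (Sym2 (Sym2 V))}
    (hB : IsDoubleBlockingSet H π k B) {v w : Fin 4 → V} (hv : IsSCUM H π B 3 v)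
    (hw : IsSCUM H π B 3 w) (h0 : v 0 = w 0) (h3 : v 3 = w 3) : v 1 ≠ w 2 := by
  intro h
  obtain ⟨v01, v12, v23, πv0, πv2, -, Bv3⟩ := hv.three
  obtain ⟨w01, w12, w23, πw0, πw2, Bw0, -⟩ := hw.three
  rw [h0, h] at v01 πv0
  rw [h] at v12 πv2 Bv3
  rw [h3] at v23 πv2 Bv3
  rcases le_total (π s(w 1, w 2)) (π s(w 2, v 2)) with hle | hle
  · obtain ⟨e', he', hmem⟩ := hB.exists_mem_of_triangle hk hπ v12 v23 w23.symm πv2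
      (by rw [Sym2.eq_swap]; exact πw2.trans hle)
    exact Bv3 e' he' hmem
  · obtain ⟨e', he', hmem⟩ := hB.exists_mem_of_triangle hk hπ w12 v01.symm w01
      (by rw [Sym2.eq_swap]; exact πv0.trans hle) πw0
    exact Bw0 e' he' hmem

/-- SCUM 3-paths with common endpoints and the same second vertex have the same third vertex. -/
theorem IsSCUM.two_eq_of_one_eq {V : Type} {k : ℕ} (hk : 3 ≤ k) {H : SimpleGraph V}
    {π : Sym2 V → ℕ} (hπ : Set.InjOn π H.edgeSet) {B : Finset (Sym2 (Sym2 V))}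
    (hB : IsDoubleBlockingSet H π k B) {v w : Fin 4 → V} (hv : IsSCUM H π B 3 v)
    (hw : IsSCUM H π B 3 w) (h3 : v 3 = w 3) (h1 : v 1 = w 1) : v 2 = w 2 := by
  by_contra h2
  have v13 : v 1 ≠ v 3 := hv.1.ne (by decide)
  obtain ⟨-, v12, v23, -, πv2, -, Bv3⟩ := hv.three
  obtain ⟨-, w12, w23, -, πw2, -, Bw3⟩ := hw.three
  rw [← h1] at w12 πw2 Bw3
  rw [← h3] at w23 πw2 Bw3
  rcases le_total (π s(v 1, w 2)) (π s(v 1, v 2)) with hle | hle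
  · obtain ⟨e', he', hmem⟩ := hB.exists_mem_of_square hk hπ v12 v23 w23.symm w12.symm v13 h2 πv2
      (by rw [Sym2.eq_swap]; exact πw2.trans hle) (by rwa [Sym2.eq_swap])
    exact Bv3 e' he' hmem
  · obtain ⟨e', he', hmem⟩ := hB.exists_mem_of_square hk hπ w12 w23 v23.symm v12.symm v13
      (Ne.symm h2) πw2 (by rw [Sym2.eq_swap]; exact πv2.trans hle) (by rwa [Sym2.eq_swap])
    exact Bw3 e' he' hmem

/-- SCUM 3-paths with common endpoints and the same third vertex have the same second vertex. -/
theorem IsSCUM.one_eq_of_two_eq {V : Type} {k : ℕ} (hk : 3 ≤ k) {H : SimpleGraph V}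
    {π : Sym2 V → ℕ} (hπ : Set.InjOn π H.edgeSet) {B : Finset (Sym2 (Sym2 V))}
    (hB : IsDoubleBlockingSet H π k B) {v w : Fin 4 → V} (hv : IsSCUM H π B 3 v)
    (hw : IsSCUM H π B 3 w) (h0 : v 0 = w 0) (h2 : v 2 = w 2) : v 1 = w 1 := by
  by_contra h1
  have v20 : v 2 ≠ v 0 := hv.1.ne (by decide)
  obtain ⟨v01, v12, -, πv0, -, Bv0, -⟩ := hv.three
  obtain ⟨w01, w12, -, πw0, -, Bw0, -⟩ := hw.three
  rw [← h2] at w12 πw0 Bw0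
  rw [← h0] at w01 πw0 Bw0
  rw [Sym2.eq_swap (a := v 1)] at πv0 Bv0
  rw [Sym2.eq_swap (a := w 1)] at πw0 Bw0
  rcases le_total (π s(v 2, w 1)) (π s(v 2, v 1)) with hle | hle
  · obtain ⟨e', he', hmem⟩ := hB.exists_mem_of_square hk hπ v12.symm v01.symm w01 w12 v20 h1
      (by rwa [Sym2.eq_swap]) (πw0.trans hle) (by rwa [Sym2.eq_swap])
    exact Bv0 e' he' hmem
  · obtain ⟨e', he', hmem⟩ := hB.exists_mem_of_square hk hπ w12.symm w01.symm v01 v12 v20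
      (Ne.symm h1) (by rwa [Sym2.eq_swap]) (πv0.trans hle) (by rwa [Sym2.eq_swap])
    exact Bw0 e' he' hmem

/-- Let `k ≥ 3`, let `H` have a linear order on its edges and a `2k`
double-blocking set `B`. Then in any SCUM `3`-path meet `{π^ℓ, π^r}`, the two paths are
internally vertex disjoint: they intersect only at their two common endpoints. -/
theorem statement_15 {V : Type} (k : ℕ) (hk : 3 ≤ k) (H : SimpleGraph V)
    (π : Sym2 V → ℕ) (hπ : Set.InjOn π H.edgeSet)
    (B : Finset (Sym2 (Sym2 V))) (hB : IsDoubleBlockingSet H π k B)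
    (vl vr : Fin 4 → V)
    (hl : IsSCUM H π B 3 vl) (hr : IsSCUM H π B 3 vr)
    (hne : vl ≠ vr) (h0 : vl 0 = vr 0) (h3 : vl 3 = vr 3) :
    ∀ i j : Fin 4, vl i = vr j → ((i = 0 ∧ j = 0) ∨ (i = 3 ∧ j = 3)) := by
  intro i j hij
  have key : ¬ (vl 1 = vr 1 ∧ vl 2 = vr 2) := fun h => hne <| by
    ext i
    fin_cases i
    exacts [h0, h.1, h.2, h3]
  have h11 : vl 1 ≠ vr 1 := fun h => key ⟨h, hl.two_eq_of_one_eq hk hπ hB hr h3 h⟩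
  have h22 : vl 2 ≠ vr 2 := fun h => key ⟨hl.one_eq_of_two_eq hk hπ hB hr h0 h, h⟩
  have h12 : vl 1 ≠ vr 2 := hl.one_ne_two hk hπ hB hr h0 h3
  have h21 : vl 2 ≠ vr 1 := (hr.one_ne_two hk hπ hB hl h0.symm h3.symm).symm
  by_cases hi0 : i = 0
  · subst hi0
    exact .inl ⟨rfl, (hr.1 (h0.symm.trans hij)).symm⟩
  by_cases hi3 : i = 3
  · subst hi3
    exact .inr ⟨rfl, (hr.1 (h3.symm.trans hij)).symm⟩
  by_cases hj0 : j = 0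
  · subst hj0
    exact absurd (hl.1 (hij.trans h0.symm)) hi0
  by_cases hj3 : j = 3
  · subst hj3
    exact absurd (hl.1 (hij.trans h3.symm)) hi3
  obtain rfl | rfl : i = 1 ∨ i = 2 := by omega
  all_goals
    obtain rfl | rfl : j = 1 ∨ j = 2 := by omega
    all_goals contradiction
end

section
/- Let k ≥ 3 be an integer, let H be a graph with a linear order on its edges, and let B be a 2k double-blocking set for H in which every edge of H appears in at most f pairs. Then for any two vertices s, t of H, there are at most f + 1 simple s–t paths in H consisting of exactly 2 edges. -/
open SimpleGraph
open scoped ENNReal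

/-- A four-cycle through two common neighbours `m₀ ≠ m` of `s ≠ t` whose last edge is
`s(s, m₀)` is blocked by a pair joining `s(s, m₀)` to an edge incident on `m`. -/
theorem exists_block_fourCycle {V : Type} {k : ℕ} (hk : 3 ≤ k) {H : SimpleGraph V}
    {π : Sym2 V → ℕ} (hπ : Set.InjOn π H.edgeSet)
    {B : Finset (Sym2 (Sym2 V))} (hB : IsDoubleBlockingSet H π k B)
    {s t m₀ m : V} (hst : s ≠ t) (hm : m₀ ≠ m)
    (hs₀ : H.Adj s m₀) (ht₀ : H.Adj t m₀) (hs : H.Adj s m) (ht : H.Adj t m)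
    (h₀ : π s(t, m₀) ≤ π s(s, m₀)) (h₁ : π s(s, m) ≤ π s(s, m₀))
    (h₂ : π s(t, m) ≤ π s(s, m₀)) :
    ∃ x, (x = s(s, m) ∨ x = s(t, m)) ∧ s(s(s, m₀), x) ∈ B := by
  obtain ⟨hB₁, -, hB₂⟩ := hB
  let p : H.Walk s s := .cons hs₀ (.cons ht₀.symm (.cons ht (.cons hs.symm .nil)))
  have hp : p.IsCycle := by
    have := hs₀.ne
    have := ht₀.ne
    have := hs.ne
    have := ht.ne
    simp only [p, Walk.cons_isCycle_iff, Walk.isPath_def, Walk.support_cons, Walk.support_nil,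
      Walk.edges_cons, Walk.edges_nil, List.nodup_cons, List.mem_cons, Sym2.eq_iff]
    grind
  have hedges : p.edges = [s(s, m₀), s(m₀, t), s(t, m), s(m, s)] := rfl
  have hblock : ∀ b ∈ B, CycleBlockedBy π p b →
      ∃ x, b = s(s(s, m₀), x) ∧ (x = s(t, m₀) ∨ x = s(s, m) ∨ x = s(t, m)) := by
    rintro b hb ⟨e₁, e₂, rfl, he₁, he₂, -, hlast⟩
    have hmax : π e₁ ≤ π s(s, m₀) := by
      rw [hedges] at he₁
      simp only [List.mem_cons, List.not_mem_nil, or_false] at he₁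
      rcases he₁ with rfl | rfl | rfl | rfl
      · exact le_rfl
      · rwa [Sym2.eq_swap]
      · exact h₂
      · rwa [Sym2.eq_swap]
    have he : e₁ = s(s, m₀) :=
      hπ (p.edges_subset_edgeSet he₁) hs₀ (hmax.antisymm (hlast _ (by simp [hedges])))
    subst he
    have hdiag : s(s, m₀) ≠ e₂ := fun h => (hB₁ _ hb).1 (by simpa using h)
    refine ⟨e₂, rfl, ?_⟩
    rw [hedges] at he₂
    simp only [List.mem_cons, List.not_mem_nil, or_false] at he₂
    rcases he₂ with h | h | h | h
    · exact absurd h.symm hdiag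
    · exact .inl (h.trans Sym2.eq_swap)
    · exact .inr (.inr h)
    · exact .inr (.inl (h.trans Sym2.eq_swap))
  obtain ⟨b₁, hb₁, b₂, hb₂, hne, hc₁, hc₂⟩ := hB₂ s p hp (by simp [p]; omega)
  obtain ⟨x, rfl, hx⟩ := hblock b₁ hb₁ hc₁
  obtain ⟨y, rfl, hy⟩ := hblock b₂ hb₂ hc₂
  rcases hx with rfl | hx
  · rcases hy with rfl | hy
    · exact absurd rfl hne
    · exact ⟨y, hy, hb₂⟩
  · exact ⟨x, hx, hb₁⟩

/-- A finite set of common neighbours of `s ≠ t` has at most `f + 1` elements if the last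
edge joining it to `{s, t}` is incident on `s` and lies in at most `f` pairs. -/
theorem card_commonNeighbors_le_of_last {V : Type} {k : ℕ} (hk : 3 ≤ k) {H : SimpleGraph V}
    {π : Sym2 V → ℕ} (hπ : Set.InjOn π H.edgeSet)
    {B : Finset (Sym2 (Sym2 V))} (hB : IsDoubleBlockingSet H π k B)
    {f : ℕ} (hf : ∀ e ∈ H.edgeSet, edgeBlockCount B e ≤ f)
    {s t : V} (hst : s ≠ t) (M : Finset V) (hM : ∀ m ∈ M, H.Adj s m ∧ H.Adj t m)
    {m₀ : V} (hm₀ : m₀ ∈ M)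
    (hlast : ∀ m ∈ M, π s(s, m) ≤ π s(s, m₀) ∧ π s(t, m) ≤ π s(s, m₀)) :
    M.card ≤ f + 1 := by
  classical
  have hex : ∀ m ∈ M.erase m₀, ∃ x, (x = s(s, m) ∨ x = s(t, m)) ∧ s(s(s, m₀), x) ∈ B := by
    intro m hm
    obtain ⟨hne, hm⟩ := Finset.mem_erase.1 hm
    exact exists_block_fourCycle hk hπ hB hst hne.symm (hM m₀ hm₀).1 (hM m₀ hm₀).2
      (hM m hm).1 (hM m hm).2 (hlast m₀ hm₀).2 (hlast m hm).1 (hlast m hm).2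
  have : Nonempty (Sym2 V) := ⟨s(s, t)⟩
  choose! g hg hgB using hex
  have hcard : (M.erase m₀).card ≤ (B.filter (s(s, m₀) ∈ ·)).card := by
    refine Finset.card_le_card_of_injOn (fun m => s(s(s, m₀), g m)) ?_ ?_
    · intro m hm
      simpa using hgB m hm
    · intro m hm m' hm' h
      have h' : g m = g m' := Sym2.congr_right.1 h
      have hs := (hM m (Finset.mem_of_mem_erase hm)).1.ne
      have ht := (hM m (Finset.mem_of_mem_erase hm)).2.ne
      have := hg m hm
      have := hg m' hm'
      grind [Sym2.eq_iff]
  have hcount : edgeBlockCount B s(s, m₀) = (B.filter (s(s, m₀) ∈ ·)).card := by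
    rw [edgeBlockCount, ← Set.ncard_coe_finset]
    simp
  have := hf s(s, m₀) (hM m₀ hm₀).1
  rw [Finset.card_erase_of_mem hm₀] at hcard
  omega

/-- Any finite set of common neighbours of `s ≠ t` has at most `f + 1` elements. -/
theorem card_commonNeighbors_le {V : Type} {k : ℕ} (hk : 3 ≤ k) {H : SimpleGraph V}
    {π : Sym2 V → ℕ} (hπ : Set.InjOn π H.edgeSet)
    {B : Finset (Sym2 (Sym2 V))} (hB : IsDoubleBlockingSet H π k B)
    {f : ℕ} (hf : ∀ e ∈ H.edgeSet, edgeBlockCount B e ≤ f)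
    {s t : V} (hst : s ≠ t) (M : Finset V) (hM : ∀ m ∈ M, H.Adj s m ∧ H.Adj t m) :
    M.card ≤ f + 1 := by
  rcases M.eq_empty_or_nonempty with rfl | hne
  · simp
  obtain ⟨m₀, hm₀, hmax⟩ := M.exists_max_image (fun m => max (π s(s, m)) (π s(t, m))) hne
  rcases le_total (π s(t, m₀)) (π s(s, m₀)) with h | h
  · refine card_commonNeighbors_le_of_last hk hπ hB hf hst M hM hm₀ fun m hm => ?_
    have := hmax m hm
    omega
  · refine card_commonNeighbors_le_of_last hk hπ hB hf hst.symm M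
      (fun m hm => (hM m hm).symm) hm₀ fun m hm => ?_
    have := hmax m hm
    omega

/-- Let `k ≥ 3`, let `H` have a linear order on its edges, and let `B` be
a `2k` double-blocking set for `H` in which every edge of `H` appears in at most `f`
pairs. Then for any two vertices `s, t` of `H`, there are at most `f + 1` simple `s–t`
paths in `H` consisting of exactly `2` edges. -/
theorem statement_16 {V : Type} (k : ℕ) (hk : 3 ≤ k) (H : SimpleGraph V)
    (π : Sym2 V → ℕ) (hπ : Set.InjOn π H.edgeSet)
    (B : Finset (Sym2 (Sym2 V))) (hB : IsDoubleBlockingSet H π k B)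
    (f : ℕ) (hf : ∀ e ∈ H.edgeSet, edgeBlockCount B e ≤ f)
    (s t : V) :
    {p : H.Walk s t | p.IsPath ∧ p.length = 2}.ncard ≤ f + 1 := by
  classical
  set P := {p : H.Walk s t | p.IsPath ∧ p.length = 2}
  rcases P.finite_or_infinite with hP | hP
  swap
  · simp [hP.ncard]
  rcases eq_or_ne s t with rfl | hst
  · have : P = ∅ := by
      ext p
      simp only [P, Set.mem_ofPred_eq, Set.mem_empty_iff_false, iff_false, not_and]
      intro hp
      simp [(Walk.isPath_iff_nil.1 hp).eq_nil]
    simp [this]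
  have hform : ∀ p ∈ P, ∃ (m : V) (h : H.Adj s m) (h' : H.Adj m t),
      p = .cons h (.cons h' .nil) := by
    rintro p ⟨-, hp⟩
    match p, hp with
    | .cons h (.cons h' .nil), _ => exact ⟨_, h, h', rfl⟩
  have hinj : Set.InjOn (fun p : H.Walk s t => p.snd) P := by
    intro p hp q hq hpq
    obtain ⟨m, h, h', rfl⟩ := hform p hp
    obtain ⟨n, i, i', rfl⟩ := hform q hq
    obtain rfl : m = n := by simpa using hpq
    rfl
  rw [Set.ncard_eq_toFinset_card P hP,
    ← Finset.card_image_of_injOn (f := fun p : H.Walk s t => p.snd) (by simpa using hinj)]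
  refine card_commonNeighbors_le hk hπ hB hf hst _ fun m hm => ?_
  obtain ⟨p, hp, rfl⟩ := Finset.mem_image.1 hm
  obtain ⟨m, h, h', rfl⟩ := hform p (hP.mem_toFinset.1 hp)
  simpa using ⟨h, h'.symm⟩
end

section
/- Let k be a positive integer, let H be a graph with a linear order on its edges, and let B be a 2k double-blocking set for H. Let π_1, π_2 be simple paths in H with the same endpoint vertices s and t, let e* ∈ π_1 be the last edge of π_1 ∪ π_2 in the order, and let F* be the set of edges e' such that {e*, e'} ∈ B. If either (i) π_1 and π_2 are both unblocked and each has at most k edges, or (ii) π_1 and π_2 are both un-double-blocked and each has at most (k+1)/2 edges, then some edge of F* ∪ {e*} lies on π_2. -/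
open SimpleGraph
open scoped ENNReal

/-- A walk splits at any of its edges. -/
theorem exists_edges_eq_append_cons {V : Type*} {G : SimpleGraph V} {u v : V} (p : G.Walk u v)
    {e : Sym2 V} (he : e ∈ p.edges) :
    ∃ (x y : V) (_ : G.Adj x y) (q : G.Walk u x) (r : G.Walk y v),
      e = s(x, y) ∧ p.edges = q.edges ++ e :: r.edges := by
  induction p with
  | nil => simp at he
  | @cons a b c h p ih =>
    by_cases hab : e = s(a, b)
    · exact ⟨a, b, h, .nil, p, hab, by simp [hab]⟩
    · obtain ⟨x, y, hxy, q, r, hexy, hp⟩ := ih (by simpa [hab] using he)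
      exact ⟨x, y, hxy, q.cons h, r, hexy, by simp [hp]⟩

/-- If an edge lies on a trail but not on a second walk with the same endpoints, then it lies
on a cycle contained in the union of the two. -/
theorem exists_isCycle_of_mem_edges_of_notMem_edges {V : Type*} {G : SimpleGraph V} {u v : V}
    {p q : G.Walk u v} (hp : p.IsTrail) {e : Sym2 V} (hep : e ∈ p.edges) (heq : e ∉ q.edges) :
    ∃ (x : V) (c : G.Walk x x), c.IsCycle ∧ e ∈ c.edges ∧
      (∀ e' ∈ c.edges, e' ∈ p.edges ∨ e' ∈ q.edges) := by
  classical
  obtain ⟨x, y, hxy, p₁, p₂, rfl, hsplit⟩ := exists_edges_eq_append_cons p hep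
  have hnodup := hp.edges_nodup
  rw [hsplit] at hnodup
  have hnot := (List.nodup_middle.mp hnodup).notMem
  let r : G.Walk y x := p₂.append (q.reverse.append p₁)
  have hr : ∀ e' ∈ r.edges, e' ∈ p₁.edges ++ p₂.edges ∨ e' ∈ q.edges := by
    intro e' he'
    simp only [r, Walk.edges_append, Walk.edges_reverse, List.mem_append, List.mem_reverse] at he' ⊢
    tauto
  refine ⟨x, r.bypass.cons hxy, (Walk.cons_isCycle_iff _ _).mpr ⟨r.bypass_isPath, fun h ↦ ?_⟩,
    by simp, fun e' he' ↦ ?_⟩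
  · exact (hr _ (r.edges_bypass_subset_edges h)).elim hnot heq
  · rw [Walk.edges_cons, List.mem_cons] at he'
    rcases he' with rfl | he'
    · exact .inl hep
    · refine (hr e' (r.edges_bypass_subset_edges he')).imp_left fun h ↦ ?_
      rw [hsplit]
      simp only [List.mem_append, List.mem_cons] at h ⊢
      tauto

/-- Let `k` be a positive integer, `H` a graph with a linear order on its
edges, `B` a `2k` double-blocking set for `H`. Let `π_1, π_2` be simple paths with the
same endpoints `s, t`, let `e* ∈ π_1` be the last edge of `π_1 ∪ π_2` in the order, and
let `F*` be the set of edges `e'` such that `{e*, e'} ∈ B`. If (i) `π_1, π_2` are both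
unblocked and have at most `k` edges each, or (ii) `π_1, π_2` are both un-double-blocked
and have at most `(k+1)/2` edges each, then some edge of `F* ∪ {e*}` lies on `π_2`. -/
theorem statement_17 {V : Type} (k : ℕ) (hk : 0 < k) (H : SimpleGraph V)
    (π : Sym2 V → ℕ) (hπ : Set.InjOn π H.edgeSet)
    (B : Finset (Sym2 (Sym2 V))) (hB : IsDoubleBlockingSet H π k B)
    {s t : V} (p1 p2 : H.Walk s t) (hp1 : p1.IsPath) (hp2 : p2.IsPath)
    (estar : Sym2 V) (hestar : estar ∈ p1.edges)
    (hlast : ∀ e : Sym2 V, e ∈ p1.edges ∨ e ∈ p2.edges → π e ≤ π estar)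
    (hcond : (¬ PathBlocked B p1 ∧ ¬ PathBlocked B p2 ∧ p1.length ≤ k ∧ p2.length ≤ k) ∨
      (¬ PathDoubleBlocked B p1 ∧ ¬ PathDoubleBlocked B p2 ∧
        2 * p1.length ≤ k + 1 ∧ 2 * p2.length ≤ k + 1)) :
    ∃ e' ∈ p2.edges, e' = estar ∨ s(estar, e') ∈ B := by
  by_contra! hcon
  obtain ⟨hdiag, hsingle, hdouble⟩ := hB
  have hnot : estar ∉ p2.edges := fun h ↦ (hcon estar h).1 rfl
  obtain ⟨x, c, hc, hec, hsub⟩ :=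
    exists_isCycle_of_mem_edges_of_notMem_edges hp1.isTrail hestar hnot
  have hlen : c.length ≤ p1.length + p2.length := by
    rw [← c.length_edges, ← p1.length_edges, ← p2.length_edges, ← List.length_append]
    exact (hc.isTrail.edges_nodup.subperm fun e he ↦ List.mem_append.mpr (hsub e he)).length_le
  have hblock : ∀ b ∈ B, CycleBlockedBy π c b → ∀ e ∈ b, e ∈ p1.edges := by
    rintro b hb ⟨e1, e2, rfl, he1, he2, -, hmax⟩
    obtain rfl : e1 = estar := hπ (c.edges_subset_edgeSet he1) (c.edges_subset_edgeSet hec)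
      (le_antisymm (hlast e1 (hsub e1 he1)) (hmax estar hec))
    have he2' : e2 ∈ p1.edges := (hsub e2 he2).resolve_right fun h ↦ (hcon e2 h).2 hb
    intro e he
    rcases Sym2.mem_iff.mp he with rfl | rfl <;> assumption
  rcases hcond with ⟨h1, -, hk1, hk2⟩ | ⟨h1, -, hk1, hk2⟩
  · obtain ⟨b, hb, hcb⟩ := hsingle x c hc (by omega)
    exact h1 ⟨b, hb, hblock b hb hcb⟩
  · obtain ⟨b, hb, b', hb', hne, hcb, hcb'⟩ := hdouble x c hc (by omega)
    exact h1 ⟨b, hb, b', hb', hne, hblock b hb hcb, hblock b' hb' hcb'⟩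
end
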